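/- (Proposition 5.5′ part (iii), weighted energy estimate for the time derivative.) Let t < T, K > 0 and γ ≥ n/2 + 3. Let g : [t,T]×ℝⁿ → ℝⁿ and l : [t,T]×ℝⁿ → ℝ be continuous with |g(s,x)| ≤ K(1+|x|) and |l(s,x)| ≤ K(1+|x|²), and let l_T : ℝⁿ → ℝ be continuously differentiable with |l_T(x)| ≤ K(1+|x|²) and |Dl_T(x)| ≤ K(1+|x|). Let J : [t,T]×ℝⁿ → ℝ have continuous ∂_sJ, DJ, D²J and ∂_sDJ, solve −∂_s J + 𝒜J − g·DJ = l on [t,T)×ℝⁿ with J(T,·) = l_T, satisfy |J(s,x)| ≤ K(1+|x|²) and ∫_t^T ∫_{ℝⁿ} |DJ|²·π_γ dx ds ≤ K, and assume for some K′ > 0 that |DJ| + |D²J| + |∂_sJ| + |∂_sDJ| ≤ K′(1+|x|²) (only to justify the integrations by parts). Then ∫_t^T ∫_{ℝⁿ} |∂_s J(s,x)|²·π_{γ+1}(x) dx ds ≤ C, with C depending only on K, γ, n, the matrix a and T−t (and not on K′). -/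

import Mathlib

open Real MeasureTheory Matrix
open scoped RealInnerProductSpace

noncomputable section

abbrev Euc (n : ℕ) := EuclideanSpace ℝ (Fin n)

/-- Second partial derivative `∂²φ/(∂x_i ∂x_j)(x)`. -/
def secondPartial (n : ℕ) (φ : Euc n → ℝ) (x : Euc n) (i j : Fin n) : ℝ :=
  fderiv ℝ (fun y => fderiv ℝ φ y (EuclideanSpace.single j 1)) x (EuclideanSpace.single i 1)

/-- The operator `𝒜φ(x) = −(1/2)·∑_{i,j} a_{ij}·∂²φ/(∂x_i∂x_j)(x)`. -/
def opA (n : ℕ) (a : Matrix (Fin n) (Fin n) ℝ) (φ : Euc n → ℝ) (x : Euc n) : ℝ :=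
  -(1 / 2) * ∑ i, ∑ j, a i j * secondPartial n φ x i j

/-- The weight `π_γ(x) = (1+|x|²)^{−γ}`. -/
def piWeight (n : ℕ) (γ : ℝ) (x : Euc n) : ℝ := (1 + ‖x‖ ^ 2) ^ (-γ)

section

open Set Filter Topology

/-- The bilinear form `∑_{i,j} a_{ij} p_i q_j`. -/
def matForm {n : ℕ} (a : Matrix (Fin n) (Fin n) ℝ) (p q : Euc n) : ℝ :=
  ∑ i, ∑ j, a i j * (p i * q j)

lemma piWeight_continuous (n : ℕ) (γ : ℝ) : Continuous (piWeight n γ) := by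
  unfold piWeight
  exact Continuous.rpow_const (by fun_prop) fun x => Or.inl (by positivity)

lemma piWeight_pos (n : ℕ) (γ : ℝ) (x : Euc n) : 0 < piWeight n γ x := by
  unfold piWeight; positivity

lemma piWeight_eq_mul (n : ℕ) (γ : ℝ) (x : Euc n) :
    piWeight n γ x = (1 + ‖x‖ ^ 2) * piWeight n (γ + 1) x := by
  have h : (0 : ℝ) < 1 + ‖x‖ ^ 2 := by positivity
  unfold piWeight
  rw [show -γ = 1 + -(γ + 1) by ring, rpow_add h, rpow_one]

lemma integrable_piWeight {n : ℕ} {γ : ℝ} (h : (n : ℝ) / 2 < γ) :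
    Integrable (piWeight n γ) := by
  have := integrable_rpow_neg_one_add_norm_sq (E := Euc n) (μ := volume) (r := 2 * γ)
    (by rw [finrank_euclideanSpace_fin]; linarith)
  refine this.congr (ae_of_all _ fun x => ?_)
  simp only [piWeight]
  congr 1; ring

lemma hasLineDerivAt_piWeight (n : ℕ) (γ : ℝ) (x : Euc n) (e : Euc n) :
    HasLineDerivAt ℝ (piWeight n γ) ⟪(-(2 * γ) * piWeight n (γ + 1) x) • x, e⟫ x e := by
  have h : (0 : ℝ) < 1 + ‖x‖ ^ 2 := by positivity
  have h1 : HasFDerivAt (fun y : Euc n => 1 + ‖y‖ ^ 2) (2 • innerSL ℝ x) x :=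
    (hasStrictFDerivAt_norm_sq x).hasFDerivAt.const_add 1
  have h2 := (h1.rpow_const (p := -γ) (Or.inl h.ne')).hasLineDerivAt e
  have h3 : ⟪(-(2 * γ) * piWeight n (γ + 1) x) • x, e⟫ =
      ((-γ * (1 + ‖x‖ ^ 2) ^ (-γ - 1)) • (2 • innerSL ℝ x)) e := by
    simp only [piWeight, real_inner_smul_left, show -(γ + 1) = -γ - 1 by ring,
      _root_.smul_apply, innerSL_apply_apply, smul_eq_mul, nsmul_eq_mul]
    push_cast
    ring
  rw [h3]
  exact h2

lemma matForm_comm {n : ℕ} {a : Matrix (Fin n) (Fin n) ℝ} (ha : aᵀ = a) (p q : Euc n) :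
    matForm a p q = matForm a q p := by
  unfold matForm
  rw [Finset.sum_comm]
  refine Finset.sum_congr rfl fun i _ => Finset.sum_congr rfl fun j _ => ?_
  rw [← Matrix.transpose_apply a, ha]; ring

lemma matForm_self_nonneg {n : ℕ} (σM : Matrix (Fin n) (Fin n) ℝ) (p : Euc n) :
    0 ≤ matForm (σM * σMᵀ) p p := by
  have : matForm (σM * σMᵀ) p p = ∑ k, (∑ i, σM i k * p i) ^ 2 := by
    simp_rw [sq, Finset.sum_mul_sum]
    rw [Finset.sum_comm]
    refine Finset.sum_congr rfl fun i _ => ?_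
    rw [Finset.sum_comm]
    refine Finset.sum_congr rfl fun j _ => ?_
    rw [Matrix.mul_apply, Finset.sum_mul]
    refine Finset.sum_congr rfl fun k _ => ?_
    rw [Matrix.transpose_apply]; ring
  rw [this]; positivity

lemma abs_coord_le {n : ℕ} (p : Euc n) (i : Fin n) : |p i| ≤ ‖p‖ := by
  simpa using PiLp.norm_apply_le p i

lemma abs_matForm_le {n : ℕ} (a : Matrix (Fin n) (Fin n) ℝ) (p q : Euc n) :
    |matForm a p q| ≤ (∑ i, ∑ j, |a i j|) * (‖p‖ * ‖q‖) := by
  unfold matForm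
  simp only [Finset.sum_mul]
  refine (Finset.abs_sum_le_sum_abs _ _).trans (Finset.sum_le_sum fun i _ => ?_)
  refine (Finset.abs_sum_le_sum_abs _ _).trans (Finset.sum_le_sum fun j _ => ?_)
  rw [abs_mul, abs_mul]
  gcongr <;> apply abs_coord_le

lemma matForm_continuous {n : ℕ} (a : Matrix (Fin n) (Fin n) ℝ) :
    Continuous fun z : Euc n × Euc n => matForm a z.1 z.2 := by
  unfold matForm
  fun_prop

lemma hasDerivAt_matForm {n : ℕ} {a : Matrix (Fin n) (Fin n) ℝ} (ha : aᵀ = a)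
    {p : ℝ → Euc n} {v : Euc n} {s : ℝ} (h : HasDerivAt p v s) :
    HasDerivAt (fun σ => matForm a (p σ) (p σ)) (2 * matForm a v (p s)) s := by
  have hc : ∀ i, HasDerivAt (fun σ => p σ i) (v i) s := fun i =>
    (EuclideanSpace.proj (𝕜 := ℝ) i).hasFDerivAt.comp_hasDerivAt s h
  have : HasDerivAt (fun σ => matForm a (p σ) (p σ))
      (∑ i, ∑ j, a i j * (v i * p s j + p s i * v j)) s := by
    unfold matForm
    exact HasDerivAt.fun_sum fun i _ => HasDerivAt.fun_sum fun j _ =>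
      ((hc i).mul (hc j)).const_mul _
  convert this using 1
  rw [two_mul]
  nth_rw 2 [matForm_comm ha]
  simp only [matForm, ← Finset.sum_add_distrib, mul_add]

lemma fderiv_single_eq {n : ℕ} (φ : Euc n → ℝ) (x : Euc n) (j : Fin n) :
    fderiv ℝ φ x (EuclideanSpace.single j 1) = gradient φ x j := by
  have h := InnerProductSpace.toDual_symm_apply (𝕜 := ℝ) (x := EuclideanSpace.single j (1 : ℝ))
    (y := fderiv ℝ φ x)
  rw [← h, EuclideanSpace.inner_single_right]
  simp [gradient]

lemma differentiable_gradient {n : ℕ} {φ : Euc n → ℝ} (h : ContDiff ℝ 2 φ) :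
    Differentiable ℝ (gradient φ) := by
  have h1 : Differentiable ℝ (fderiv ℝ φ) :=
    (h.fderiv_right (m := 1) (by norm_num)).differentiable (by norm_num)
  exact (InnerProductSpace.toDual ℝ (Euc n)).symm.toContinuousLinearEquiv.differentiable.comp h1

lemma hasLineDerivAt_gradient {n : ℕ} {φ : Euc n → ℝ} (h : ContDiff ℝ 2 φ) (x e : Euc n)
    (j : Fin n) :
    HasLineDerivAt ℝ (fun y => gradient φ y j) (fderiv ℝ (gradient φ) x e j) x e :=
  ((EuclideanSpace.proj (𝕜 := ℝ) j).hasFDerivAt.comp x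
    (differentiable_gradient h x).hasFDerivAt).hasLineDerivAt e

lemma secondPartial_eq {n : ℕ} {φ : Euc n → ℝ} (h : ContDiff ℝ 2 φ) (x : Euc n) (i j : Fin n) :
    secondPartial n φ x i j = fderiv ℝ (gradient φ) x (EuclideanSpace.single i 1) j := by
  have hd : HasFDerivAt (fun y => gradient φ y j) _ x :=
    (EuclideanSpace.proj (𝕜 := ℝ) j).hasFDerivAt.comp x (differentiable_gradient h x).hasFDerivAt
  rw [secondPartial, funext fun y => fderiv_single_eq φ y j, hd.fderiv]
  rfl

lemma hasLineDerivAt_deriv {n : ℕ} {J : ℝ → Euc n → ℝ} {t T s : ℝ} (hs : s ∈ Ioo t T)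
    (hJs : ∀ x, DifferentiableAt ℝ (fun σ' => J σ' x) s)
    (hJx : ∀ s ∈ Icc t T, Differentiable ℝ (J s))
    (hp : ∀ s ∈ Icc t T, Continuous (gradient (J s)))
    (hpd : ∀ x, ∀ s ∈ Icc t T, DifferentiableAt ℝ (fun σ' => gradient (J σ') x) s)
    (hv : ∀ s ∈ Icc t T, Continuous fun x => deriv (fun σ' => gradient (J σ') x) s)
    {b : Euc n → ℝ} (hb : Continuous b)
    (hvb : ∀ s ∈ Icc t T, ∀ x, ‖deriv (fun σ' => gradient (J σ') x) s‖ ≤ b x)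
    (x e : Euc n) :
    HasLineDerivAt ℝ (fun x => deriv (fun σ' => J σ' x) s)
      ⟪deriv (fun σ' => gradient (J σ') x) s, e⟫ x e := by
  have hIcc := Ioo_subset_Icc_self hs
  have hnhds : Ioo t T ∈ 𝓝 s := isOpen_Ioo.mem_nhds hs
  have hline : Continuous fun ρ : ℝ => x + ρ • e := by fun_prop
  have hcv : Continuous fun ρ : ℝ => ⟪deriv (fun σ' => gradient (J σ') (x + ρ • e)) s, e⟫ :=
    ((hv s hIcc).comp hline).inner continuous_const
  have hcp : ∀ σ ∈ Icc t T, Continuous fun ρ : ℝ => ⟪gradient (J σ) (x + ρ • e), e⟫ :=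
    fun σ hσ => ((hp σ hσ).comp hline).inner continuous_const
  have ftc : ∀ σ ∈ Icc t T, ∀ r : ℝ,
      J σ (x + r • e) = J σ x + ∫ ρ in (0 : ℝ)..r, ⟪gradient (J σ) (x + ρ • e), e⟫ := by
    intro σ hσ r
    rw [intervalIntegral.integral_eq_sub_of_hasDerivAt (f := fun ρ => J σ (x + ρ • e))
      _ ((hcp σ hσ).intervalIntegrable _ _)]
    · simp
    · intro ρ _
      have h1 : HasDerivAt (fun ρ : ℝ => x + ρ • e) e ρ := by
        simpa using ((hasDerivAt_id ρ).smul_const e).const_add x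
      have h2 := (hJx σ hσ (x + ρ • e)).hasGradientAt.hasFDerivAt.comp_hasDerivAt ρ h1
      simpa [Function.comp_def] using h2
  have key : ∀ r : ℝ, deriv (fun σ' => J σ' (x + r • e)) s = deriv (fun σ' => J σ' x) s +
      ∫ ρ in (0 : ℝ)..r, ⟪deriv (fun σ' => gradient (J σ') (x + ρ • e)) s, e⟫ := by
    intro r
    have h1 := (intervalIntegral.hasDerivAt_integral_of_dominated_loc_of_deriv_le
      (μ := volume) (a := 0) (b := r)
      (F := fun σ ρ => ⟪gradient (J σ) (x + ρ • e), e⟫)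
      (F' := fun σ ρ => ⟪deriv (fun σ' => gradient (J σ') (x + ρ • e)) σ, e⟫)
      (bound := fun ρ => b (x + ρ • e) * ‖e‖) hnhds
      (by filter_upwards [hnhds] with σ hσ
          exact (hcp σ (Ioo_subset_Icc_self hσ)).aestronglyMeasurable)
      ((hcp s hIcc).intervalIntegrable _ _) hcv.aestronglyMeasurable
      (ae_of_all _ fun ρ _ σ hσ => by
        refine (norm_inner_le_norm _ _).trans ?_
        gcongr
        exact hvb σ (Ioo_subset_Icc_self hσ) _)
      (((hb.comp hline).mul continuous_const).intervalIntegrable _ _)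
      (ae_of_all _ fun ρ _ σ hσ => by
        have := (hpd (x + ρ • e) σ (Ioo_subset_Icc_self hσ)).hasDerivAt.inner ℝ
          (hasDerivAt_const σ e)
        simpa using this)).2
    have h2 := (hJs x).hasDerivAt.add h1
    refine (h2.congr_of_eventuallyEq ?_).deriv
    filter_upwards [hnhds] with σ hσ
    exact ftc σ (Ioo_subset_Icc_self hσ) r
  unfold HasLineDerivAt
  simp only [key]
  have := ((hcv.integral_hasStrictDerivAt 0 0).hasDerivAt).const_add
    (deriv (fun σ' => J σ' x) s)
  simpa using this

lemma integrable_of_abs_le_piWeight {n : ℕ} {γ : ℝ} (hγ : (n : ℝ) / 2 + 3 ≤ γ) {f : Euc n → ℝ}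
    (hf : Continuous f) {c : ℝ}
    (hc : ∀ x, |f x| ≤ c * ((1 + ‖x‖ ^ 2) ^ 2 * piWeight n γ x)) : Integrable f := by
  refine ((integrable_piWeight (n := n) (γ := γ - 2) (by linarith)).const_mul c).mono'
    hf.aestronglyMeasurable (ae_of_all _ fun x => (hc x).trans_eq ?_)
  rw [piWeight_eq_mul n (γ - 2), piWeight_eq_mul n (γ - 2 + 1)]
  ring_nf

lemma norm_le_one_add_sq {n : ℕ} (x : Euc n) : ‖x‖ ≤ 1 + ‖x‖ ^ 2 := by
  nlinarith [sq_nonneg (‖x‖ - 1)]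

/-- Multiplying `𝒜ψ` by `u·π_{γ+1}` and integrating by parts in space. -/
lemma integral_mul_opA_mul_piWeight {n : ℕ} (a : Matrix (Fin n) (Fin n) ℝ) {γ K' : ℝ}
    (hγ : (n : ℝ) / 2 + 3 ≤ γ) {ψ u : Euc n → ℝ} {v : Euc n → Euc n}
    (hψ : ContDiff ℝ 2 ψ) (hu : Continuous u) (hv : Continuous v)
    (hH : Continuous fun x => fderiv ℝ (gradient ψ) x)
    (huv : ∀ x e, HasLineDerivAt ℝ u ⟪v x, e⟫ x e)
    (bu : ∀ x, |u x| ≤ K' * (1 + ‖x‖ ^ 2)) (bv : ∀ x, ‖v x‖ ≤ K' * (1 + ‖x‖ ^ 2))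
    (bp : ∀ x, ‖gradient ψ x‖ ≤ K' * (1 + ‖x‖ ^ 2))
    (bH : ∀ x, ‖fderiv ℝ (gradient ψ) x‖ ≤ K' * (1 + ‖x‖ ^ 2)) :
    Integrable (fun x => u x * opA n a ψ x * piWeight n (γ + 1) x) ∧
    Integrable (fun x => 1 / 2 * (matForm a (v x) (gradient ψ x) * piWeight n (γ + 1) x) -
      (γ + 1) * piWeight n (γ + 2) x * u x * matForm a x (gradient ψ x)) ∧
    ∫ x, u x * opA n a ψ x * piWeight n (γ + 1) x =
      ∫ x, (1 / 2 * (matForm a (v x) (gradient ψ x) * piWeight n (γ + 1) x) -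
        (γ + 1) * piWeight n (γ + 2) x * u x * matForm a x (gradient ψ x)) := by
  have hγ0 : 0 ≤ γ + 1 := by have : (0 : ℝ) ≤ n := n.cast_nonneg; linarith
  have hp : Continuous (gradient ψ) := (differentiable_gradient hψ).continuous
  have hw := piWeight_continuous n (γ + 1)
  have hw2 := piWeight_continuous n (γ + 2)
  have hq : ∀ x : Euc n, 1 ≤ 1 + ‖x‖ ^ 2 := fun x => by nlinarith [sq_nonneg ‖x‖]
  have hK' : 0 ≤ K' := by simpa using (abs_nonneg _).trans (bu 0)
  let D : Fin n → Euc n → ℝ := fun i x =>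
    v x i * piWeight n (γ + 1) x + u x * (-(2 * (γ + 1)) * piWeight n (γ + 2) x * x i)
  let H : Fin n → Fin n → Euc n → ℝ := fun i j x =>
    fderiv ℝ (gradient ψ) x (EuclideanSpace.single i 1) j
  have ww2 : ∀ x, piWeight n (γ + 1) x = (1 + ‖x‖ ^ 2) * piWeight n (γ + 2) x := fun x => by
    rw [piWeight_eq_mul]; ring_nf
  have i1 : ∀ i j, Integrable fun x => D i x * gradient ψ x j := by
    intro i j
    refine integrable_of_abs_le_piWeight hγ (by fun_prop)
      (c := K' ^ 2 + 2 * (γ + 1) * K' ^ 2) fun x => ?_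
    have hx := abs_coord_le x i
    have hx2 := norm_le_one_add_sq x
    have w2 := piWeight_pos n (γ + 2) x
    have e1 : |D i x| ≤ K' * (1 + ‖x‖ ^ 2) * piWeight n (γ + 1) x +
        K' * (1 + ‖x‖ ^ 2) * (2 * (γ + 1) * piWeight n (γ + 2) x * (1 + ‖x‖ ^ 2)) := by
      refine (abs_add_le _ _).trans ?_
      rw [abs_mul, abs_mul, abs_mul, abs_mul, abs_neg, abs_of_nonneg (by positivity :
        0 ≤ 2 * (γ + 1)), abs_of_pos (piWeight_pos _ _ _), abs_of_pos w2]
      gcongr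
      · exact (piWeight_pos _ _ _).le
      · exact (abs_coord_le _ _).trans (bv x)
      · exact bu x
      · exact hx.trans hx2
    rw [abs_mul]
    calc _ ≤ (K' * (1 + ‖x‖ ^ 2) * piWeight n (γ + 1) x +
        K' * (1 + ‖x‖ ^ 2) * (2 * (γ + 1) * piWeight n (γ + 2) x * (1 + ‖x‖ ^ 2)))
          * (K' * (1 + ‖x‖ ^ 2)) := by
          gcongr
          · exact (abs_nonneg _).trans e1
          · exact (abs_coord_le _ _).trans (bp x)
      _ = (K' ^ 2 + 2 * (γ + 1) * K' ^ 2) * ((1 + ‖x‖ ^ 2) ^ 2 * piWeight n (γ + 1) x) := by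
          rw [ww2]; ring
      _ ≤ (K' ^ 2 + 2 * (γ + 1) * K' ^ 2) * ((1 + ‖x‖ ^ 2) ^ 2 * piWeight n γ x) := by
          rw [piWeight_eq_mul n γ]
          gcongr
          exact le_mul_of_one_le_left (piWeight_pos _ _ _).le (hq x)
  have bound2 : ∀ (f : Euc n → ℝ), Continuous f → (∀ x, |f x| ≤ K' * (1 + ‖x‖ ^ 2)) →
      Integrable fun x => u x * piWeight n (γ + 1) x * f x := by
    intro f hf bf
    refine integrable_of_abs_le_piWeight hγ (by fun_prop) (c := K' ^ 2) fun x => ?_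
    rw [abs_mul, abs_mul, abs_of_pos (piWeight_pos _ _ _)]
    have w1 := piWeight_pos n (γ + 1) x
    calc _ ≤ K' * (1 + ‖x‖ ^ 2) * piWeight n (γ + 1) x * (K' * (1 + ‖x‖ ^ 2)) := by
          gcongr
          · exact bu x
          · exact bf x
      _ = K' ^ 2 * ((1 + ‖x‖ ^ 2) ^ 2 * piWeight n (γ + 1) x) := by ring
      _ ≤ _ := by
          rw [piWeight_eq_mul n γ]
          gcongr
          exact le_mul_of_one_le_left w1.le (hq x)
  have i2 : ∀ i j, Integrable fun x => u x * piWeight n (γ + 1) x * H i j x := by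
    intro i j
    refine bound2 _ ?_ fun x => (abs_coord_le _ _).trans ?_
    · have := hH.clm_apply (continuous_const (y := EuclideanSpace.single i (1 : ℝ)))
      fun_prop
    · refine (ContinuousLinearMap.le_opNorm _ _).trans ?_
      simpa using bH x
  have i3 : ∀ j, Integrable fun x => u x * piWeight n (γ + 1) x * gradient ψ x j := fun j =>
    bound2 _ (by fun_prop) fun x => (abs_coord_le _ _).trans (bp x)
  have ibp : ∀ i j, ∫ x, u x * piWeight n (γ + 1) x * H i j x =
      -∫ x, D i x * gradient ψ x j := by
    intro i j
    refine integral_bilinear_hasLineDerivAt_right_eq_neg_left_of_integrable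
      (B := ContinuousLinearMap.mul ℝ ℝ) (v := EuclideanSpace.single i 1)
      (f := fun x => u x * piWeight n (γ + 1) x) (f' := D i)
      (g := fun x => gradient ψ x j) (g' := H i j) (i1 i j) (i2 i j) (i3 j)
      (fun x _ => ?_) (fun x _ => hasLineDerivAt_gradient hψ x _ j)
    have h1 := huv x (EuclideanSpace.single i 1)
    have h2 := hasLineDerivAt_piWeight n (γ + 1) x (EuclideanSpace.single i 1)
    have h3 := HasDerivAt.mul h1 h2
    simp only [zero_smul, add_zero, EuclideanSpace.inner_single_right, PiLp.smul_apply,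
      smul_eq_mul, one_mul, conj_trivial] at h3
    rw [show γ + 1 + 1 = γ + 2 by ring] at h3
    exact h3
  have e1 : ∀ x, u x * opA n a ψ x * piWeight n (γ + 1) x =
      ∑ i, ∑ j, (-(1 / 2) * a i j) * (u x * piWeight n (γ + 1) x * H i j x) := by
    intro x
    simp only [opA, secondPartial_eq hψ, Finset.mul_sum, Finset.sum_mul]
    refine Finset.sum_congr rfl fun i _ => Finset.sum_congr rfl fun j _ => ?_
    simp only [H]; ring
  have e2 : ∀ x, 1 / 2 * (matForm a (v x) (gradient ψ x) * piWeight n (γ + 1) x) -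
        (γ + 1) * piWeight n (γ + 2) x * u x * matForm a x (gradient ψ x) =
      ∑ i, ∑ j, (-(1 / 2) * a i j) * -(D i x * gradient ψ x j) := by
    intro x
    simp only [matForm, Finset.mul_sum, Finset.sum_mul, ← Finset.sum_sub_distrib]
    refine Finset.sum_congr rfl fun i _ => Finset.sum_congr rfl fun j _ => ?_
    simp only [D]; ring
  have j1 : ∀ i j, Integrable fun x =>
    (-(1 / 2) * a i j) * (u x * piWeight n (γ + 1) x * H i j x) := fun i j => (i2 i j).const_mul _
  have j2 : ∀ i j, Integrable fun x =>
    (-(1 / 2) * a i j) * -(D i x * gradient ψ x j) := fun i j => (i1 i j).neg.const_mul _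
  simp only [e1, e2]
  refine ⟨integrable_finsetSum _ fun i _ => integrable_finsetSum _ fun j _ => j1 i j,
    integrable_finsetSum _ fun i _ => integrable_finsetSum _ fun j _ => j2 i j, ?_⟩
  rw [integral_finsetSum _ fun i _ => integrable_finsetSum _ fun j _ => j1 i j,
    integral_finsetSum _ fun i _ => integrable_finsetSum _ fun j _ => j2 i j]
  refine Finset.sum_congr rfl fun i _ => ?_
  rw [integral_finsetSum _ fun j _ => j1 i j, integral_finsetSum _ fun j _ => j2 i j]
  refine Finset.sum_congr rfl fun j _ => ?_
  rw [integral_const_mul, integral_const_mul, integral_neg, ibp]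

lemma mul_le_eighth_add (u b P : ℝ) : u * (b * P) ≤ 1 / 8 * u ^ 2 + 2 * b ^ 2 * P ^ 2 := by
  nlinarith [sq_nonneg (u - 4 * (b * P))]

/-- The pointwise Young inequality absorbing the lower-order terms. -/
lemma lower_order_le {M K c u N G L P X q w w2 : ℝ} (hM : 0 ≤ M) (hc : 0 ≤ c)
    (hP : 0 ≤ P) (hq : q = 1 + X ^ 2) (hw2 : 0 ≤ w2) (hw : w = q * w2)
    (hN : |N| ≤ M * (X * P)) (hG : |G| ≤ K * (1 + X) * P) (hL : |L| ≤ K * q) :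
    -(c * w2 * u * N) - u * G * w - u * L * w ≤
      1 / 2 * (u ^ 2 * w) + (2 * (M * c) ^ 2 + 4 * K ^ 2) * (P ^ 2 * (q * w)) +
        K ^ 2 * (q * (q * w)) := by
  have hXq : X ≤ q := by nlinarith [sq_nonneg (X - 1)]
  have hq1 : 1 ≤ q := by nlinarith
  have hw0 : 0 ≤ w := by rw [hw]; positivity
  have h1 : -(c * w2 * u * N) ≤ |u| * ((M * c) * P) * w := by
    calc -(c * w2 * u * N) ≤ |c * w2 * u * N| := neg_le_abs _
      _ = c * w2 * |u| * |N| := by rw [abs_mul, abs_mul, abs_mul, abs_of_nonneg hc,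
            abs_of_nonneg hw2]
      _ ≤ c * w2 * |u| * (M * (q * P)) := by gcongr; exact hN.trans (by gcongr)
      _ = _ := by rw [hw]; ring
  have h2 : -(u * G) ≤ |u| * ((K * (1 + X)) * P) := by
    calc -(u * G) ≤ |u * G| := neg_le_abs _
      _ = |u| * |G| := abs_mul _ _
      _ ≤ _ := by gcongr
  have h3 : -(u * L) ≤ |u| * (K * q) := by
    calc -(u * L) ≤ |u * L| := neg_le_abs _
      _ = |u| * |L| := abs_mul _ _
      _ ≤ _ := by gcongr
  have g1 := mul_le_eighth_add |u| (M * c) P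
  have g2 := mul_le_eighth_add |u| (K * (1 + X)) P
  have g3 : |u| * (K * q) ≤ 1 / 4 * |u| ^ 2 + K ^ 2 * q ^ 2 := by
    nlinarith [sq_nonneg (|u| - 2 * (K * q))]
  rw [sq_abs] at g1 g2 g3
  have k2 : 2 * (K * (1 + X)) ^ 2 * P ^ 2 ≤ 4 * K ^ 2 * P ^ 2 * q := by
    have : (1 + X) ^ 2 ≤ 2 * q := by nlinarith [sq_nonneg (X - 1)]
    nlinarith [mul_le_mul_of_nonneg_left this (by positivity : 0 ≤ K ^ 2 * P ^ 2)]
  have k1 : 2 * (M * c) ^ 2 * P ^ 2 ≤ 2 * (M * c) ^ 2 * P ^ 2 * q :=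
    le_mul_of_one_le_right (by positivity) hq1
  have f1 := mul_le_mul_of_nonneg_right (g1.trans (add_le_add_right k1 _)) hw0
  have f2 := mul_le_mul_of_nonneg_right (h2.trans (g2.trans (add_le_add_right k2 _))) hw0
  have f3 := mul_le_mul_of_nonneg_right (h3.trans g3) hw0
  nlinarith [h1, f1, f2, f3]

/-- Energy estimate on a fixed time slice. -/
lemma slice_estimate {n : ℕ} (a : Matrix (Fin n) (Fin n) ℝ) {γ K K' : ℝ}
    (hγ : (n : ℝ) / 2 + 3 ≤ γ) {ψ u l : Euc n → ℝ} {v g : Euc n → Euc n}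
    (hψ : ContDiff ℝ 2 ψ) (hu : Continuous u) (hv : Continuous v)
    (hH : Continuous fun x => fderiv ℝ (gradient ψ) x)
    (huv : ∀ x e, HasLineDerivAt ℝ u ⟪v x, e⟫ x e)
    (bu : ∀ x, |u x| ≤ K' * (1 + ‖x‖ ^ 2)) (bv : ∀ x, ‖v x‖ ≤ K' * (1 + ‖x‖ ^ 2))
    (bp : ∀ x, ‖gradient ψ x‖ ≤ K' * (1 + ‖x‖ ^ 2))
    (bH : ∀ x, ‖fderiv ℝ (gradient ψ) x‖ ≤ K' * (1 + ‖x‖ ^ 2))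
    (bg : ∀ x, ‖g x‖ ≤ K * (1 + ‖x‖)) (bl : ∀ x, |l x| ≤ K * (1 + ‖x‖ ^ 2))
    (heq : ∀ x, -u x + opA n a ψ x - ⟪g x, gradient ψ x⟫ = l x)
    (iu : Integrable fun x => u x ^ 2 * piWeight n (γ + 1) x)
    (ivp : Integrable fun x => matForm a (v x) (gradient ψ x) * piWeight n (γ + 1) x)
    (ip : Integrable fun x => ‖gradient ψ x‖ ^ 2 * piWeight n γ x) :
    ∫ x, u x ^ 2 * piWeight n (γ + 1) x ≤
      (∫ x, matForm a (v x) (gradient ψ x) * piWeight n (γ + 1) x) +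
      2 * (2 * ((∑ i, ∑ j, |a i j|) * (γ + 1)) ^ 2 + 4 * K ^ 2) *
        (∫ x, ‖gradient ψ x‖ ^ 2 * piWeight n γ x) +
      2 * K ^ 2 * ∫ x, piWeight n (γ - 1) x := by
  have hγ0 : 0 ≤ γ + 1 := by have : (0 : ℝ) ≤ n := n.cast_nonneg; linarith
  obtain ⟨hi1, hi2, heq2⟩ := integral_mul_opA_mul_piWeight a hγ hψ hu hv hH huv bu bv bp bH
  have iR : Integrable fun x =>
      u x ^ 2 * piWeight n (γ + 1) x - u x * opA n a ψ x * piWeight n (γ + 1) x := iu.sub hi1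
  have iW := integrable_piWeight (n := n) (γ := γ - 1) (by linarith)
  set c1 := 2 * ((∑ i, ∑ j, |a i j|) * (γ + 1)) ^ 2 + 4 * K ^ 2 with hc1
  have k1 : Integrable fun x => 1 / 2 * (matForm a (v x) (gradient ψ x) * piWeight n (γ + 1) x) +
      1 / 2 * (u x ^ 2 * piWeight n (γ + 1) x) := (ivp.const_mul _).add (iu.const_mul _)
  have k2 : Integrable fun x => c1 * (‖gradient ψ x‖ ^ 2 * piWeight n γ x) +
      K ^ 2 * piWeight n (γ - 1) x := (ip.const_mul _).add (iW.const_mul _)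
  have split : ∫ x, u x ^ 2 * piWeight n (γ + 1) x =
      ∫ x, ((1 / 2 * (matForm a (v x) (gradient ψ x) * piWeight n (γ + 1) x) -
        (γ + 1) * piWeight n (γ + 2) x * u x * matForm a x (gradient ψ x)) +
        (u x ^ 2 * piWeight n (γ + 1) x - u x * opA n a ψ x * piWeight n (γ + 1) x)) := by
    rw [integral_add hi2 iR, ← heq2, integral_sub iu hi1]
    ring
  have hle : ∫ x, u x ^ 2 * piWeight n (γ + 1) x ≤
      ∫ x, ((1 / 2 * (matForm a (v x) (gradient ψ x) * piWeight n (γ + 1) x) +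
        1 / 2 * (u x ^ 2 * piWeight n (γ + 1) x)) +
        (c1 * (‖gradient ψ x‖ ^ 2 * piWeight n γ x) + K ^ 2 * piWeight n (γ - 1) x)) := by
    rw [split]
    refine integral_mono (hi2.add iR) (k1.add k2) fun x => ?_
    have hG : |⟪g x, gradient ψ x⟫| ≤ K * (1 + ‖x‖) * ‖gradient ψ x‖ :=
      (abs_real_inner_le_norm _ _).trans (by gcongr; exact bg x)
    have h := lower_order_le (u := u x) (by positivity : 0 ≤ ∑ i, ∑ j, |a i j|) hγ0
      (norm_nonneg (gradient ψ x)) rfl (piWeight_pos n (γ + 2) x).le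
      (w := piWeight n (γ + 1) x) (by rw [piWeight_eq_mul]; ring_nf)
      (abs_matForm_le a x (gradient ψ x)) hG (bl x)
    rw [← piWeight_eq_mul, show (1 + ‖x‖ ^ 2) * piWeight n γ x = piWeight n (γ - 1) x by
      rw [piWeight_eq_mul n (γ - 1)]; ring_nf] at h
    have hA : opA n a ψ x = u x + ⟪g x, gradient ψ x⟫ + l x := by linarith [heq x]
    simp only [hA]
    rw [← hc1] at h
    linarith [h]
  rw [integral_add k1 k2, integral_add (ivp.const_mul _) (iu.const_mul _),
    integral_add (ip.const_mul _) (iW.const_mul _), integral_const_mul, integral_const_mul,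
    integral_const_mul, integral_const_mul] at hle
  linarith

section Slices

variable {n : ℕ} {t T : ℝ} {X : Type*} [TopologicalSpace X] {F : ℝ × Euc n → X}

lemma continuous_slice (hF : ContinuousOn F (Icc t T ×ˢ univ)) {s : ℝ} (hs : s ∈ Icc t T) :
    Continuous fun x => F (s, x) := by
  rw [← continuousOn_univ]
  exact hF.comp (by fun_prop) fun x _ => ⟨hs, mem_univ _⟩

lemma continuousOn_time (hF : ContinuousOn F (Icc t T ×ˢ univ)) (x : Euc n) :
    ContinuousOn (fun s => F (s, x)) (Icc t T) :=
  hF.comp (by fun_prop) fun _ hs => ⟨hs, mem_univ _⟩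

end Slices

lemma integrable_sq_mul_piWeight {n : ℕ} {γ : ℝ} (hγ : (n : ℝ) / 2 + 3 ≤ γ) :
    Integrable fun x : Euc n => (1 + ‖x‖ ^ 2) ^ 2 * piWeight n γ x :=
  integrable_of_abs_le_piWeight hγ (by have := piWeight_continuous n γ; fun_prop) (c := 1)
    fun x => by
      rw [one_mul, abs_of_nonneg]
      have := piWeight_pos n γ x
      positivity

lemma continuousOn_integral_of_abs_le_piWeight {n : ℕ} {γ t T c : ℝ}
    (hγ : (n : ℝ) / 2 + 3 ≤ γ) {F : ℝ × Euc n → ℝ} (hF : ContinuousOn F (Icc t T ×ˢ univ))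
    (hc : ∀ s ∈ Icc t T, ∀ x, |F (s, x)| ≤ c * ((1 + ‖x‖ ^ 2) ^ 2 * piWeight n γ x)) :
    ContinuousOn (fun s => ∫ x, F (s, x)) (Icc t T) :=
  continuousOn_of_dominated (fun _ hs => (continuous_slice hF hs).aestronglyMeasurable)
    (fun s hs => ae_of_all _ (hc s hs)) ((integrable_sq_mul_piWeight hγ).const_mul c)
    (ae_of_all _ fun x => continuousOn_time hF x)

end

/-- **Proposition 5.5′ (iii).** Weighted energy estimate for the time
derivative of a solution of `−∂_s J + 𝒜J − g·DJ = l`, `J(T,·) = l_T`: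
`∫_t^T ∫ |∂_s J|² π_{γ+1} ≤ C`, with `C` depending only on `K`, `γ`, `n`, `a` and `T−t`
(and not on `K′`). -/
theorem time_derivative_energy_estimate_linear
    (n : ℕ) (hn : 1 ≤ n) (σM : Matrix (Fin n) (Fin n) ℝ) (hσ : IsUnit σM.det)
    (a : Matrix (Fin n) (Fin n) ℝ) (ha : a = σM * σMᵀ)
    (t T K γ : ℝ) (htT : t < T) (hK : 0 < K) (hγ : (n : ℝ) / 2 + 3 ≤ γ) :
    ∃ C > (0 : ℝ),
      ∀ (g : ℝ → Euc n → Euc n) (l : ℝ → Euc n → ℝ) (lT : Euc n → ℝ) (J : ℝ → Euc n → ℝ),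
      -- continuity and growth of the coefficients
      ContinuousOn (fun p : ℝ × Euc n => g p.1 p.2) (Set.Icc t T ×ˢ Set.univ) →
      (∀ s ∈ Set.Icc t T, ∀ x : Euc n, ‖g s x‖ ≤ K * (1 + ‖x‖)) →
      ContinuousOn (fun p : ℝ × Euc n => l p.1 p.2) (Set.Icc t T ×ˢ Set.univ) →
      (∀ s ∈ Set.Icc t T, ∀ x : Euc n, |l s x| ≤ K * (1 + ‖x‖ ^ 2)) →
      -- l_T continuously differentiable with the stated growths
      ContDiff ℝ 1 lT →
      (∀ x : Euc n, |lT x| ≤ K * (1 + ‖x‖ ^ 2)) →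
      (∀ x : Euc n, ‖gradient lT x‖ ≤ K * (1 + ‖x‖)) →
      -- regularity of J : continuous ∂_sJ, DJ, D²J and ∂_sDJ
      (∀ x : Euc n, ∀ s ∈ Set.Icc t T, DifferentiableAt ℝ (fun σ' => J σ' x) s) →
      (∀ s ∈ Set.Icc t T, ContDiff ℝ 2 (J s)) →
      ContinuousOn (fun p : ℝ × Euc n => deriv (fun σ' => J σ' p.2) p.1)
        (Set.Icc t T ×ˢ Set.univ) →
      ContinuousOn (fun p : ℝ × Euc n => gradient (J p.1) p.2) (Set.Icc t T ×ˢ Set.univ) →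
      ContinuousOn (fun p : ℝ × Euc n => fderiv ℝ (gradient (J p.1)) p.2)
        (Set.Icc t T ×ˢ Set.univ) →
      (∀ x : Euc n, ∀ s ∈ Set.Icc t T, DifferentiableAt ℝ (fun σ' => gradient (J σ') x) s) →
      ContinuousOn (fun p : ℝ × Euc n => deriv (fun σ' => gradient (J σ') p.2) p.1)
        (Set.Icc t T ×ˢ Set.univ) →
      -- the equation with terminal data l_T
      (∀ s ∈ Set.Ico t T, ∀ x : Euc n,
        -(deriv (fun σ' => J σ' x) s) + opA n a (J s) x - ⟪g s x, gradient (J s) x⟫ = l s x) →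
      (∀ x : Euc n, J T x = lT x) →
      -- quadratic growth of J and the gradient energy bound
      (∀ s ∈ Set.Icc t T, ∀ x : Euc n, |J s x| ≤ K * (1 + ‖x‖ ^ 2)) →
      (∫ s in t..T, ∫ x : Euc n, ‖gradient (J s) x‖ ^ 2 * piWeight n γ x) ≤ K →
      -- the auxiliary bound with some K′ (only to justify integrations by parts)
      (∃ K' > (0 : ℝ), ∀ s ∈ Set.Icc t T, ∀ x : Euc n,
        ‖gradient (J s) x‖ + ‖fderiv ℝ (gradient (J s)) x‖ + |deriv (fun σ' => J σ' x) s|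
          + ‖deriv (fun σ' => gradient (J σ') x) s‖ ≤ K' * (1 + ‖x‖ ^ 2)) →
      -- conclusion
      (∫ s in t..T, ∫ x : Euc n,
        (deriv (fun σ' => J σ' x) s) ^ 2 * piWeight n (γ + 1) x) ≤ C := by
  have hn0 : (0 : ℝ) ≤ n := n.cast_nonneg
  set M : ℝ := ∑ i, ∑ j, |a i j| with hM
  have hM0 : 0 ≤ M := by positivity
  set P : ℝ := ∫ x, piWeight n (γ - 1) x with hP
  have hP0 : 0 ≤ P := integral_nonneg fun x => (piWeight_pos n _ x).le
  set c1 : ℝ := 2 * (M * (γ + 1)) ^ 2 + 4 * K ^ 2 with hc1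
  have hc10 : 0 ≤ c1 := by positivity
  have hat : aᵀ = a := by rw [ha, Matrix.transpose_mul, Matrix.transpose_transpose]
  have hTt : 0 < T - t := by linarith
  refine ⟨M * K ^ 2 * P + 2 * c1 * K + 2 * K ^ 2 * P * (T - t) + 1, by positivity, ?_⟩
  intro g l lT J _ bg _ bl _ _ blT hJs hJx cu cp cH hpd cv heq hJT _ hG hK'
  obtain ⟨K', hK'0, hb⟩ := hK'
  have bp : ∀ s ∈ Set.Icc t T, ∀ x, ‖gradient (J s) x‖ ≤ K' * (1 + ‖x‖ ^ 2) := fun s hs x => by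
    linarith [hb s hs x, norm_nonneg (fderiv ℝ (gradient (J s)) x),
      abs_nonneg (deriv (fun σ' => J σ' x) s), norm_nonneg (deriv (fun σ' => gradient (J σ') x) s)]
  have bH : ∀ s ∈ Set.Icc t T, ∀ x, ‖fderiv ℝ (gradient (J s)) x‖ ≤ K' * (1 + ‖x‖ ^ 2) :=
    fun s hs x => by
    linarith [hb s hs x, norm_nonneg (gradient (J s) x),
      abs_nonneg (deriv (fun σ' => J σ' x) s), norm_nonneg (deriv (fun σ' => gradient (J σ') x) s)]
  have bu : ∀ s ∈ Set.Icc t T, ∀ x, |deriv (fun σ' => J σ' x) s| ≤ K' * (1 + ‖x‖ ^ 2) :=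
    fun s hs x => by
    linarith [hb s hs x, norm_nonneg (gradient (J s) x),
      norm_nonneg (fderiv ℝ (gradient (J s)) x),
      norm_nonneg (deriv (fun σ' => gradient (J σ') x) s)]
  have bv : ∀ s ∈ Set.Icc t T, ∀ x,
      ‖deriv (fun σ' => gradient (J σ') x) s‖ ≤ K' * (1 + ‖x‖ ^ 2) := fun s hs x => by
    linarith [hb s hs x, norm_nonneg (gradient (J s) x),
      norm_nonneg (fderiv ℝ (gradient (J s)) x), abs_nonneg (deriv (fun σ' => J σ' x) s)]
  have hw1 : ∀ x, piWeight n (γ + 1) x ≤ piWeight n γ x := fun x => by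
    rw [piWeight_eq_mul n γ]
    exact le_mul_of_one_le_left (piWeight_pos _ _ _).le (by nlinarith [sq_nonneg ‖x‖])
  have cw : ∀ β, Continuous fun z : ℝ × Euc n => piWeight n β z.2 :=
    fun β => (piWeight_continuous n β).comp continuous_snd
  -- joint continuity of the four integrands
  have cU : ContinuousOn (fun z : ℝ × Euc n =>
      (deriv (fun σ' => J σ' z.2) z.1) ^ 2 * piWeight n (γ + 1) z.2)
      (Set.Icc t T ×ˢ Set.univ) := (cu.pow 2).mul (cw _).continuousOn
  have cVP : ContinuousOn (fun z : ℝ × Euc n =>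
      matForm a (deriv (fun σ' => gradient (J σ') z.2) z.1) (gradient (J z.1) z.2) *
        piWeight n (γ + 1) z.2) (Set.Icc t T ×ˢ Set.univ) :=
    ((matForm_continuous a).comp_continuousOn (cv.prodMk cp)).mul (cw _).continuousOn
  have cPP : ContinuousOn (fun z : ℝ × Euc n =>
      matForm a (gradient (J z.1) z.2) (gradient (J z.1) z.2) * piWeight n (γ + 1) z.2)
      (Set.Icc t T ×ˢ Set.univ) :=
    ((matForm_continuous a).comp_continuousOn (cp.prodMk cp)).mul (cw _).continuousOn
  have cG : ContinuousOn (fun z : ℝ × Euc n => ‖gradient (J z.1) z.2‖ ^ 2 * piWeight n γ z.2)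
      (Set.Icc t T ×ˢ Set.univ) := (cp.norm.pow 2).mul (cw _).continuousOn
  -- domination
  have bU : ∀ s ∈ Set.Icc t T, ∀ x, |(deriv (fun σ' => J σ' x) s) ^ 2 * piWeight n (γ + 1) x| ≤
      K' ^ 2 * ((1 + ‖x‖ ^ 2) ^ 2 * piWeight n γ x) := fun s hs x => by
    rw [abs_mul, abs_pow, abs_of_pos (piWeight_pos _ _ _), ← mul_assoc, ← mul_pow]
    have := piWeight_pos n (γ + 1) x
    gcongr
    · exact bu s hs x
    · exact hw1 x
  have bform : ∀ p q x, ‖p‖ ≤ K' * (1 + ‖x‖ ^ 2) → ‖q‖ ≤ K' * (1 + ‖x‖ ^ 2) →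
      |matForm a p q * piWeight n (γ + 1) x| ≤
        (M * K' ^ 2) * ((1 + ‖x‖ ^ 2) ^ 2 * piWeight n γ x) := fun p q x h1 h2 => by
    have := piWeight_pos n (γ + 1) x
    rw [abs_mul, abs_of_pos this]
    calc _ ≤ M * ((K' * (1 + ‖x‖ ^ 2)) * (K' * (1 + ‖x‖ ^ 2))) * piWeight n γ x := by
          gcongr
          · exact (abs_matForm_le a p q).trans (by gcongr)
          · exact hw1 x
      _ = _ := by ring
  have bG : ∀ s ∈ Set.Icc t T, ∀ x, |‖gradient (J s) x‖ ^ 2 * piWeight n γ x| ≤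
      K' ^ 2 * ((1 + ‖x‖ ^ 2) ^ 2 * piWeight n γ x) := fun s hs x => by
    have := piWeight_pos n γ x
    rw [abs_mul, abs_pow, abs_of_pos this, abs_norm, ← mul_assoc, ← mul_pow]
    gcongr
    exact bp s hs x
  have bVP := fun s hs x => bform _ _ x (bv s hs x) (bp s hs x)
  have bPP := fun s hs x => bform _ _ x (bp s hs x) (bp s hs x)
  have iU := (continuousOn_integral_of_abs_le_piWeight hγ cU bU).intervalIntegrable_of_Icc
    (μ := volume) htT.le
  have iVP := (continuousOn_integral_of_abs_le_piWeight hγ cVP bVP).intervalIntegrable_of_Icc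
    (μ := volume) htT.le
  have iG := (continuousOn_integral_of_abs_le_piWeight hγ cG bG).intervalIntegrable_of_Icc
    (μ := volume) htT.le
  have contE := continuousOn_integral_of_abs_le_piWeight hγ cPP bPP
  -- the estimate on each time slice
  have hslice : ∀ s ∈ Set.Ioo t T,
      (∫ x, (deriv (fun σ' => J σ' x) s) ^ 2 * piWeight n (γ + 1) x) ≤
      (∫ x, matForm a (deriv (fun σ' => gradient (J σ') x) s) (gradient (J s) x) *
        piWeight n (γ + 1) x) +
      2 * c1 * (∫ x, ‖gradient (J s) x‖ ^ 2 * piWeight n γ x) + 2 * K ^ 2 * P := by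
    intro s hs
    have hs' := Set.Ioo_subset_Icc_self hs
    refine slice_estimate a hγ (hJx s hs') (continuous_slice cu hs')
      (continuous_slice cv hs') (continuous_slice cH hs') (fun x e => ?_) (bu s hs') (bv s hs')
      (bp s hs') (bH s hs') (bg s hs') (bl s hs') (heq s (Set.Ioo_subset_Ico_self hs))
      (integrable_of_abs_le_piWeight hγ (continuous_slice cU hs') (bU s hs'))
      (integrable_of_abs_le_piWeight hγ (continuous_slice cVP hs') (bVP s hs'))
      (integrable_of_abs_le_piWeight hγ (continuous_slice cG hs') (bG s hs'))
    exact hasLineDerivAt_deriv hs (fun x => hJs x s hs')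
      (fun s hs => (hJx s hs).differentiable (by norm_num)) (fun s hs => continuous_slice cp hs)
      hpd (fun s hs => continuous_slice cv hs) (by fun_prop) bv x e
  -- the energy identity in time
  have henergy : ∀ s ∈ Set.Ioo t T, HasDerivAt
      (fun σ => ∫ x, matForm a (gradient (J σ) x) (gradient (J σ) x) * piWeight n (γ + 1) x)
      (2 * ∫ x, matForm a (deriv (fun σ' => gradient (J σ') x) s) (gradient (J s) x) *
        piWeight n (γ + 1) x) s := by
    intro s hs
    have hnhds : Set.Ioo t T ∈ nhds s := isOpen_Ioo.mem_nhds hs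
    have hs' := Set.Ioo_subset_Icc_self hs
    have h := (hasDerivAt_integral_of_dominated_loc_of_deriv_le (μ := volume)
      (F := fun σ x => matForm a (gradient (J σ) x) (gradient (J σ) x) * piWeight n (γ + 1) x)
      (F' := fun σ x => 2 * (matForm a (deriv (fun σ' => gradient (J σ') x) σ)
        (gradient (J σ) x) * piWeight n (γ + 1) x))
      (bound := fun x => 2 * ((M * K' ^ 2) * ((1 + ‖x‖ ^ 2) ^ 2 * piWeight n γ x))) hnhds
      (by filter_upwards [hnhds] with σ hσ
          exact (continuous_slice cPP (Set.Ioo_subset_Icc_self hσ)).aestronglyMeasurable)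
      (integrable_of_abs_le_piWeight hγ (continuous_slice cPP hs') (bPP s hs'))
      ((continuous_slice cVP hs').const_mul 2).aestronglyMeasurable
      (ae_of_all _ fun x σ hσ => by
        rw [norm_mul, Real.norm_ofNat, Real.norm_eq_abs]
        gcongr
        exact bVP σ (Set.Ioo_subset_Icc_self hσ) x)
      (((integrable_sq_mul_piWeight hγ).const_mul _).const_mul _)
      (ae_of_all _ fun x σ hσ => by
        have := (hasDerivAt_matForm hat (hpd x σ (Set.Ioo_subset_Icc_self hσ)).hasDerivAt).mul_const
          (piWeight n (γ + 1) x)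
        rwa [mul_assoc] at this)).2
    rwa [integral_const_mul] at h
  have hftc := intervalIntegral.integral_eq_sub_of_hasDerivAt_of_le htT.le contE henergy
    (iVP.const_mul 2)
  rw [intervalIntegral.integral_const_mul] at hftc
  have hEt : 0 ≤ ∫ x, matForm a (gradient (J t) x) (gradient (J t) x) * piWeight n (γ + 1) x :=
    integral_nonneg fun x => mul_nonneg (ha ▸ matForm_self_nonneg σM _) (piWeight_pos _ _ _).le
  have hET : ∫ x, matForm a (gradient (J T) x) (gradient (J T) x) * piWeight n (γ + 1) x ≤
      2 * M * K ^ 2 * P := by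
    have hTT : T ∈ Set.Icc t T := ⟨htT.le, le_rfl⟩
    rw [hP, ← integral_const_mul]
    refine integral_mono
      (integrable_of_abs_le_piWeight hγ (continuous_slice cPP hTT) (bPP T hTT))
      ((integrable_piWeight (by linarith)).const_mul _) fun x => ?_
    have hw := piWeight_pos n (γ + 1) x
    have hp : ‖gradient (J T) x‖ ≤ K * (1 + ‖x‖) := by rw [funext hJT]; exact blT x
    calc _ ≤ M * ((K * (1 + ‖x‖)) * (K * (1 + ‖x‖))) * piWeight n (γ + 1) x := by
          gcongr
          exact (le_abs_self _).trans ((abs_matForm_le a _ _).trans (by gcongr))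
      _ = M * K ^ 2 * (1 + ‖x‖) ^ 2 * piWeight n (γ + 1) x := by ring
      _ ≤ M * K ^ 2 * (2 * (1 + ‖x‖ ^ 2)) * piWeight n (γ + 1) x := by
          gcongr
          nlinarith [sq_nonneg (‖x‖ - 1)]
      _ = 2 * M * K ^ 2 * piWeight n γ x := by rw [piWeight_eq_mul n γ]; ring
      _ ≤ 2 * M * K ^ 2 * piWeight n (γ - 1) x := by
          gcongr
          rw [piWeight_eq_mul n (γ - 1), sub_add_cancel]
          exact le_mul_of_one_le_left (piWeight_pos _ _ _).le (by nlinarith [sq_nonneg ‖x‖])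
  have hmain := intervalIntegral.integral_mono_on_of_le_Ioo htT.le iU
    ((iVP.add (iG.const_mul (2 * c1))).add (intervalIntegrable_const (c := 2 * K ^ 2 * P))) hslice
  rw [intervalIntegral.integral_add (iVP.add (iG.const_mul (2 * c1))) intervalIntegrable_const,
    intervalIntegral.integral_add iVP (iG.const_mul (2 * c1)),
    intervalIntegral.integral_const_mul, intervalIntegral.integral_const, smul_eq_mul] at hmain
  have hGK := mul_le_mul_of_nonneg_left hG (by positivity : 0 ≤ 2 * c1)
  linarith [hmain]

end
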